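/- Let S be a well-connected polyhedral mapping. Then Hof S = sup{Lipusc S(b) : b ∈ dom S} = sup{clm S(b,x) : (b,x) ∈ gph S}. -/

import Mathlib

open scoped ENNReal
open Filter EMetric Set

/-- Calmness modulus of a set-valued mapping `M` at `(ybar, xbar)`. -/
noncomputable def clmMod {Y X : Type*} [PseudoEMetricSpace Y] [PseudoEMetricSpace X]
    (M : Y → Set X) (ybar : Y) (xbar : X) : ℝ≥0∞ :=
  Filter.limsup
    (fun x => EMetric.infEdist x (M ybar) / EMetric.infEdist ybar {y | x ∈ M y}) (nhds xbar)

/-- Lipschitz upper semicontinuity modulus of `M` at `ybar`. -/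
noncomputable def lipuscMod {Y X : Type*} [PseudoEMetricSpace Y] [PseudoEMetricSpace X]
    (M : Y → Set X) (ybar : Y) : ℝ≥0∞ :=
  Filter.limsup
    (fun y => ⨆ x ∈ M y, EMetric.infEdist x (M ybar) / edist y ybar) (nhds ybar)

/-- Hoffman constant of `M`. -/
noncomputable def hofConst {Y X : Type*} [PseudoEMetricSpace Y] [PseudoEMetricSpace X]
    (M : Y → Set X) : ℝ≥0∞ :=
  ⨆ y ∈ {y | (M y).Nonempty}, ⨆ x : X,
    EMetric.infEdist x (M y) / EMetric.infEdist y {y' | x ∈ M y'}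

/-- A convex polyhedral subset: a finite intersection of closed half-spaces. -/
def IsPolyhedral {E : Type*} [NormedAddCommGroup E] [NormedSpace ℝ E] (C : Set E) : Prop :=
  ∃ (k : ℕ) (f : Fin k → E →L[ℝ] ℝ) (c : Fin k → ℝ), C = {x | ∀ i, f i x ≤ c i}

/-- `S = ⋃_{i ∈ I} S_i` is a well-connected polyhedral mapping. -/
structure IsWellConnectedPolyhedral {Y X I : Type*}
    [NormedAddCommGroup Y] [NormedSpace ℝ Y] [NormedAddCommGroup X] [NormedSpace ℝ X]
    [Finite I] (S : Y → Set X) (Si : I → Y → Set X) : Prop where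
  graph_nonempty : ∀ i, {p : Y × X | p.2 ∈ Si i p.1}.Nonempty
  graph_polyhedral : ∀ i, IsPolyhedral {p : Y × X | p.2 ∈ Si i p.1}
  union : ∀ b, S b = ⋃ i, Si i b
  dom_convex : Convex ℝ {b | (S b).Nonempty}
  restrict : ∀ i b, (Si i b).Nonempty → S b = Si i b

open Metric in
theorem lipuscMod_le_hofConst {Y X : Type*} [PseudoEMetricSpace Y] [PseudoEMetricSpace X]
    {M : Y → Set X} {b : Y} (hb : (M b).Nonempty) : lipuscMod M b ≤ hofConst M := by
  refine limsup_le_of_le (h := Eventually.of_forall fun y => iSup₂_le fun x hx => ?_)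
  refine le_trans ?_ (le_iSup₂_of_le b hb (le_iSup _ x))
  refine ENNReal.div_le_div_left ?_ _
  rw [edist_comm]
  exact infEDist_le_edist_of_mem hx

open Metric in
theorem clmMod_le_lipuscMod {Y X : Type*} [PseudoEMetricSpace Y] [PseudoEMetricSpace X]
    {M : Y → Set X} {b : Y} {x : X} (hx : x ∈ M b) : clmMod M b x ≤ lipuscMod M b := by
  refine le_of_forall_gt_imp_ge_of_dense fun L hL => ?_
  rcases eq_or_ne L ⊤ with rfl | hLtop
  · exact le_top
  have hL0 : L ≠ 0 := (pos_of_gt hL).ne'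
  obtain ⟨δ, hδ, hball⟩ := nhds_basis_eball.eventually_iff.1 (eventually_lt_of_limsup_lt hL)
  have hnear : ∀ᶠ x' in nhds x, edist x' x < L * δ :=
    nhds_basis_eball.eventually_iff.2 ⟨L * δ, ENNReal.mul_pos hL0 hδ.ne', fun {_} h => h⟩
  refine limsup_le_of_le (h := hnear.mono fun x' hx' => ?_)
  refine ENNReal.div_le_of_le_mul ?_
  change infEDist x' (M b) ≤ L * infEDist b {y | x' ∈ M y}
  rw [← ENNReal.div_le_iff' hL0 hLtop]
  refine le_infEDist.2 fun y hy => ?_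
  rw [ENNReal.div_le_iff' hL0 hLtop, edist_comm]
  rcases lt_or_ge (edist y b) δ with hyb | hyb
  · have h := (le_iSup₂ (f := fun x (_ : x ∈ M y) => infEDist x (M b) / edist y b)
      x' hy).trans (hball hyb).le
    rcases eq_or_ne (edist y b) 0 with h0 | h0
    · rw [h0] at h ⊢
      by_contra hne
      have : infEDist x' (M b) ≠ 0 := fun h' => hne (by simp [h'])
      rw [ENNReal.div_zero this] at h
      exact hLtop (top_le_iff.1 h)
    · rcases eq_or_ne (edist y b) ⊤ with ht | ht
      · simp [ht, hL0]
      · exact (ENNReal.div_le_iff h0 ht).1 h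
  · exact (infEDist_le_edist_of_mem hx).trans (hx'.le.trans (by gcongr))

theorem exists_between_of_finite {L U : Set ℝ} (hL : L.Finite) (hU : U.Finite)
    (h : ∀ l ∈ L, ∀ u ∈ U, l ≤ u) : ∃ r, (∀ l ∈ L, l ≤ r) ∧ ∀ u ∈ U, r ≤ u := by
  rcases L.eq_empty_or_nonempty with rfl | hne
  · obtain ⟨r, hr⟩ := hU.bddBelow
    exact ⟨r, by simp, hr⟩
  · exact ⟨sSup L, fun l hl => le_csSup hL.bddAbove hl,
      fun u hu => csSup_le hne fun l hl => h l hl u hu⟩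

section Polyhedral

variable {E : Type*} [NormedAddCommGroup E] [NormedSpace ℝ E]

theorem isPolyhedral_of_finite {κ : Type*} [Finite κ] (f : κ → E →L[ℝ] ℝ) (c : κ → ℝ) :
    IsPolyhedral {x | ∀ i, f i x ≤ c i} := by
  let e := Finite.equivFin κ
  refine ⟨Nat.card κ, f ∘ e.symm, c ∘ e.symm, ?_⟩
  ext x
  exact (e.symm.forall_congr_right (q := fun i => f i x ≤ c i)).symm

theorem IsPolyhedral.isClosed {C : Set E} (hC : IsPolyhedral C) : IsClosed C := by
  obtain ⟨k, f, c, rfl⟩ := hC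
  simp only [ofPred_forall]
  exact isClosed_iInter fun i => isClosed_le (f i).continuous continuous_const

theorem IsPolyhedral.convex {C : Set E} (hC : IsPolyhedral C) : Convex ℝ C := by
  obtain ⟨k, f, c, rfl⟩ := hC
  simp only [ofPred_forall]
  exact convex_iInter fun i => convex_halfSpace_le (f i).toLinearMap.isLinear (c i)

/-- One step of Fourier–Motzkin elimination. -/
theorem IsPolyhedral.add_line {C : Set E} (hC : IsPolyhedral C) (v : E) :
    IsPolyhedral {x | ∃ r : ℝ, x + r • v ∈ C} := by
  obtain ⟨k, f, c, rfl⟩ := hC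
  let κ := {i : Fin k // f i v = 0} ⊕ {p : Fin k × Fin k // 0 < f p.1 v ∧ f p.2 v < 0}
  let g : κ → E →L[ℝ] ℝ := Sum.elim (fun i => f i.1)
    fun p => (f p.1.1 v) • f p.1.2 - (f p.1.2 v) • f p.1.1
  let d : κ → ℝ := Sum.elim (fun i => c i.1)
    fun p => (f p.1.1 v) * c p.1.2 - (f p.1.2 v) * c p.1.1
  convert isPolyhedral_of_finite g d using 1
  ext x
  simp only [mem_ofPred_eq, map_add, map_smul, smul_eq_mul, κ, g, d, Sum.forall, Sum.elim_inl,
    Sum.elim_inr, Subtype.forall, Prod.forall, _root_.sub_apply,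
    _root_.smul_apply]
  constructor
  · rintro ⟨r, hr⟩
    refine ⟨fun i hi => by simpa [hi] using hr i, fun i j hij => ?_⟩
    have h1 := mul_le_mul_of_nonneg_left (hr j) hij.1.le
    have h2 := mul_le_mul_of_nonpos_left (hr i) hij.2.le
    linarith
  · rintro ⟨h0, hpn⟩
    obtain ⟨r, hl, hu⟩ := exists_between_of_finite
      (L := (fun j => (c j - f j x) / f j v) '' {j | f j v < 0})
      (U := (fun i => (c i - f i x) / f i v) '' {i | 0 < f i v})
      (toFinite _) (toFinite _) (by
        rintro _ ⟨j, hj, rfl⟩ _ ⟨i, hi, rfl⟩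
        change f j v < 0 at hj
        change 0 < f i v at hi
        have := hpn i j ⟨hi, hj⟩
        rw [div_le_iff_of_neg hj, div_mul_eq_mul_div, div_le_iff₀ hi]
        linarith)
    refine ⟨r, fun i => ?_⟩
    rcases lt_trichotomy (f i v) 0 with hi | hi | hi
    · have := hl _ ⟨i, hi, rfl⟩
      rw [div_le_iff_of_neg hi] at this
      linarith
    · simpa [hi] using h0 i hi
    · have := hu _ ⟨i, hi, rfl⟩
      rw [le_div_iff₀ hi] at this
      linarith

theorem IsPolyhedral.add_submodule {C : Set E} (hC : IsPolyhedral C) (N : Submodule ℝ E)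
    (hN : N.FG) : IsPolyhedral {x | ∃ v ∈ N, x + v ∈ C} := by
  induction N, hN using Submodule.fg_induction generalizing C with
  | singleton v =>
    convert hC.add_line v using 1
    ext x
    simp [Submodule.mem_span_singleton]
  | sup N₁ N₂ _ _ h₁ h₂ =>
    convert h₂ (h₁ hC) using 1
    ext x
    simp only [mem_ofPred_eq, Submodule.mem_sup]
    constructor
    · rintro ⟨_, ⟨y, hy, z, hz, rfl⟩, h⟩
      exact ⟨z, hz, y, hy, by rwa [add_assoc, add_comm z y]⟩
    · rintro ⟨z, hz, y, hy, h⟩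
      exact ⟨_, ⟨y, hy, z, hz, rfl⟩, by rwa [add_comm y z, ← add_assoc]⟩

theorem IsPolyhedral.isClosed_dom {Y X : Type*} [NormedAddCommGroup Y] [NormedSpace ℝ Y]
    [NormedAddCommGroup X] [NormedSpace ℝ X] [FiniteDimensional ℝ X] {M : Y → Set X}
    (hM : IsPolyhedral {p : Y × X | p.2 ∈ M p.1}) : IsClosed {b | (M b).Nonempty} := by
  have h := (hM.add_submodule (LinearMap.range (LinearMap.inr ℝ Y X))
    (Module.Finite.iff_fg.1 inferInstance)).isClosed
  convert h.preimage (Continuous.prodMk_left (0 : X)) using 1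
  ext b
  simp [Set.Nonempty]

end Polyhedral

section Estimate

variable {Y X : Type*} [NormedAddCommGroup Y] [NormedSpace ℝ Y]
  [NormedAddCommGroup X] [NormedSpace ℝ X] [FiniteDimensional ℝ X]

open Metric in
/-- A bound on the calmness moduli of a mapping propagates along a convex closed piece of it. -/
theorem exists_dist_le_of_clmMod_lt {S T : Y → Set X} {K : NNReal}
    (hT : Convex ℝ {p : Y × X | p.2 ∈ T p.1}) (hclosed : ∀ b, IsClosed (T b))
    (hST : ∀ b, (T b).Nonempty → S b = T b)
    (hclm : ∀ b, ∀ x ∈ S b, clmMod S b x < K) {b b' : Y} {x : X} (hx : x ∈ T b)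
    (hb' : (T b').Nonempty) : ∃ z ∈ T b', dist x z ≤ K * dist b b' := by
  obtain ⟨z, hz, hxz⟩ := (hclosed b').exists_infDist_eq_dist hb' x
  refine ⟨z, hz, ?_⟩
  have hSb' := hST b' hb'
  have hev := eventually_lt_of_limsup_lt (hclm b' z (hSb' ▸ hz))
  have hlim : Tendsto (fun t : ℝ => AffineMap.lineMap x z t) (nhdsWithin 1 (Ico 0 1))
      (nhds z) := by
    have : Continuous (fun t : ℝ => AffineMap.lineMap (k := ℝ) x z t) :=
      AffineMap.lineMap_continuous
    have h := this.tendsto 1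
    rw [AffineMap.lineMap_apply_one] at h
    exact h.mono_left nhdsWithin_le_nhds
  have hne : (nhdsWithin (1 : ℝ) (Ico 0 1)).NeBot := by
    rw [nhdsWithin_Ico_eq_nhdsLT one_pos]
    infer_instance
  obtain ⟨t, ht, ht0, ht1⟩ := ((hlim.eventually hev).and self_mem_nhdsWithin).exists
  set w : X := AffineMap.lineMap x z t with hw
  set y : Y := AffineMap.lineMap b b' t with hy
  have hwy : w ∈ T y := by
    have h : AffineMap.lineMap (b, x) (b', z) t ∈ {p : Y × X | p.2 ∈ T p.1} :=
      hT.lineMap_mem hx hz ⟨ht0, ht1.le⟩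
    simpa [hw, hy, AffineMap.lineMap_apply] using h
  have hwS : w ∈ S y := hST y ⟨w, hwy⟩ ▸ hwy
  rw [hSb'] at ht
  have hle : infEDist w (T b') ≤ K * edist b' y := by
    change infEDist w (T b') / infEDist b' {y | w ∈ S y} < K at ht
    have hbd : infEDist b' {y | w ∈ S y} ≤ edist b' y := infEDist_le_edist_of_mem hwS
    refine le_trans ?_ (mul_le_mul_right hbd _)
    refine (ENNReal.div_le_iff_le_mul (Or.inr ENNReal.coe_ne_top) (Or.inl ?_)).1 ht.le
    exact ne_top_of_le_ne_top (edist_ne_top _ _) hbd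
  have hle' : infDist w (T b') ≤ K * dist b' y := by
    have h := ENNReal.toReal_mono (ENNReal.mul_ne_top ENNReal.coe_ne_top (edist_ne_top _ _)) hle
    rwa [ENNReal.toReal_mul, ← dist_edist, ENNReal.coe_toReal] at h
  have h1 : dist b' y = (1 - t) * dist b b' := by
    rw [hy, dist_comm, dist_lineMap_right, Real.norm_of_nonneg (by linarith)]
  have h2 : dist x w = t * dist x z := by
    rw [hw, dist_left_lineMap, Real.norm_of_nonneg ht0]
  have h3 : infDist x (T b') ≤ infDist w (T b') + dist x w := infDist_le_infDist_add_dist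
  rw [hxz, h2] at h3
  rw [h1] at hle'
  have h4 : (1 - t) * dist x z ≤ (1 - t) * (K * dist b b') := by linarith
  exact le_of_mul_le_mul_left h4 (by linarith)

end Estimate

section WellConnected

variable {Y X I : Type*} [NormedAddCommGroup Y] [NormedSpace ℝ Y]
  [NormedAddCommGroup X] [NormedSpace ℝ X] [Finite I]
  {S : Y → Set X} {Si : I → Y → Set X}

theorem IsWellConnectedPolyhedral.isClosed_graph (hS : IsWellConnectedPolyhedral S Si) :
    IsClosed {p : Y × X | p.2 ∈ S p.1} := by
  have : {p : Y × X | p.2 ∈ S p.1} = ⋃ i, {p : Y × X | p.2 ∈ Si i p.1} := by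
    ext p
    simp [hS.union]
  rw [this]
  exact isClosed_iUnion_of_finite fun i => (hS.graph_polyhedral i).isClosed

theorem IsWellConnectedPolyhedral.exists_dist_le [FiniteDimensional ℝ X]
    (hS : IsWellConnectedPolyhedral S Si)
    {K : NNReal} (hclm : ∀ b, ∀ x ∈ S b, clmMod S b x < K) {b b' : Y} {x : X} (hx : x ∈ S b)
    (hb' : (S b').Nonempty) : ∃ z ∈ S b', dist x z ≤ K * dist b b' := by
  let γ : ℝ → Y := fun t => AffineMap.lineMap b b' t
  have hγ : Continuous γ := AffineMap.lineMap_continuous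
  have hγd : ∀ s t, dist (γ s) (γ t) = |s - t| * dist b b' := fun s t => by
    rw [dist_lineMap_lineMap, Real.dist_eq]
  have hdom : ∀ t ∈ Icc (0 : ℝ) 1, (S (γ t)).Nonempty := fun t ht =>
    hS.dom_convex.lineMap_mem ⟨x, hx⟩ hb' ht
  let A : Set ℝ := {t | ∃ z ∈ S (γ t), dist x z ≤ K * (t * dist b b')}
  suffices h : Icc (0 : ℝ) 1 ⊆ A by
    obtain ⟨z, hz, hxz⟩ := h (right_mem_Icc.2 zero_le_one)
    exact ⟨z, by simpa [γ] using hz, by simpa using hxz⟩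
  refine IsClosed.Icc_subset_of_forall_exists_gt ?_ ⟨x, by simpa [γ] using hx, by simp⟩ ?_
  · let P : Set (ℝ × X) := (Icc 0 1 ×ˢ Metric.closedBall x (K * dist b b')) ∩
      {p | p.2 ∈ S (γ p.1) ∧ dist x p.2 ≤ K * (p.1 * dist b b')}
    have hP : IsCompact P := by
      refine (isCompact_Icc.prod (isCompact_closedBall _ _)).inter_right (IsClosed.inter ?_ ?_)
      · exact hS.isClosed_graph.preimage
          (f := fun p : ℝ × X => (γ p.1, p.2)) (by fun_prop)
      · exact isClosed_le (f := fun p : ℝ × X => dist x p.2)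
          (g := fun p : ℝ × X => K * (p.1 * dist b b')) (by fun_prop) (by fun_prop)
    convert (hP.image continuous_fst).isClosed using 1
    ext t
    constructor
    · rintro ⟨⟨z, hz, hxz⟩, ht⟩
      refine ⟨(t, z), ⟨⟨ht, ?_⟩, hz, hxz⟩, rfl⟩
      rw [Metric.mem_closedBall, dist_comm]
      refine hxz.trans ?_
      gcongr
      exact mul_le_of_le_one_left dist_nonneg ht.2
    · rintro ⟨⟨s, z⟩, ⟨⟨hs, -⟩, hz, hxz⟩, rfl⟩
      exact ⟨⟨z, hz, hxz⟩, hs⟩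
  · rintro t ⟨⟨z, hz, hxz⟩, ht0, ht1⟩ u (hu : t < u)
    let J : Set ℝ := Ioc t (min u 1)
    let D : I → Set ℝ := fun i => {s | (Si i (γ s)).Nonempty}
    have hJ : J ⊆ ⋃ i, J ∩ D i := by
      rintro s hs
      obtain ⟨w, hw⟩ := hdom s ⟨ht0.trans hs.1.le, hs.2.trans (min_le_right _ _)⟩
      rw [hS.union] at hw
      obtain ⟨i, hi⟩ := mem_iUnion.1 hw
      exact mem_iUnion.2 ⟨i, hs, w, hi⟩
    have htJ : t ∈ closure J := by
      rw [closure_Ioc (lt_min hu ht1).ne]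
      exact left_mem_Icc.2 (lt_min hu ht1).le
    have htU := closure_mono hJ htJ
    rw [closure_iUnion_of_finite] at htU
    obtain ⟨i, hi⟩ := mem_iUnion.1 htU
    have hDi : IsClosed (D i) := (hS.graph_polyhedral i).isClosed_dom.preimage hγ
    have htD : (Si i (γ t)).Nonempty := closure_minimal inter_subset_right hDi hi
    obtain ⟨s, hsJ, hsD⟩ := closure_nonempty_iff.1 ⟨t, hi⟩
    rw [hS.restrict i _ htD] at hz
    obtain ⟨w, hw, hzw⟩ := exists_dist_le_of_clmMod_lt (hS.graph_polyhedral i).convex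
      (fun b => (hS.graph_polyhedral i).isClosed.preimage (Continuous.prodMk_right b))
      (hS.restrict i) hclm hz hsD
    refine ⟨s, ⟨w, hS.restrict i _ hsD ▸ hw, ?_⟩, hsJ.1, hsJ.2.trans (min_le_left _ _)⟩
    rw [hγd, abs_sub_comm, abs_of_pos (sub_pos.2 hsJ.1)] at hzw
    linarith [dist_triangle x z w]

open Metric in
theorem IsWellConnectedPolyhedral.hofConst_le_iSup_clmMod [FiniteDimensional ℝ X]
    (hS : IsWellConnectedPolyhedral S Si) :
    hofConst S ≤ ⨆ b : Y, ⨆ x ∈ S b, clmMod S b x := by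
  refine le_of_forall_gt_imp_ge_of_dense fun K hK => ?_
  induction K with
  | top => exact le_top
  | coe K =>
    have hclm : ∀ b, ∀ x ∈ S b, clmMod S b x < K := fun b x hx =>
      lt_of_le_of_lt (le_iSup_of_le b (le_iSup₂ (f := fun x (_ : x ∈ S b) => clmMod S b x) x hx)) hK
    have hK0 : (K : ℝ≥0∞) ≠ 0 := (pos_of_gt hK).ne'
    refine iSup₂_le fun b hb => iSup_le fun x => ENNReal.div_le_of_le_mul ?_
    change infEDist x (S b) ≤ K * infEDist b {y | x ∈ S y}
    rw [← ENNReal.div_le_iff' hK0 ENNReal.coe_ne_top]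
    refine le_infEDist.2 fun y hy => ?_
    rw [ENNReal.div_le_iff' hK0 ENNReal.coe_ne_top]
    obtain ⟨z, hz, hxz⟩ := hS.exists_dist_le hclm hy hb
    refine (infEDist_le_edist_of_mem hz).trans ?_
    rw [edist_nndist, edist_nndist, nndist_comm b y]
    exact_mod_cast hxz

end WellConnected

/-- Let `S` be a well-connected polyhedral mapping. Then
`Hof S = sup{Lipusc S(b) : b ∈ dom S} = sup{clm S(b,x) : (b,x) ∈ gph S}`. -/
theorem hof_eq_sup_lipusc_eq_sup_clm_of_wellConnected {Y X I : Type*}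
    [NormedAddCommGroup Y] [NormedSpace ℝ Y] [FiniteDimensional ℝ Y]
    [NormedAddCommGroup X] [NormedSpace ℝ X] [FiniteDimensional ℝ X]
    [Finite I] (S : Y → Set X) (Si : I → Y → Set X)
    (hS : IsWellConnectedPolyhedral S Si) :
    hofConst S = (⨆ b ∈ {b | (S b).Nonempty}, lipuscMod S b) ∧
    hofConst S = ⨆ b : Y, ⨆ x ∈ S b, clmMod S b x := by
  have hcl : (⨆ b : Y, ⨆ x ∈ S b, clmMod S b x) ≤ ⨆ b ∈ {b | (S b).Nonempty}, lipuscMod S b :=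
    iSup_le fun b => iSup₂_le fun x hx => (clmMod_le_lipuscMod hx).trans <|
      le_iSup₂ (f := fun b (_ : b ∈ {b | (S b).Nonempty}) => lipuscMod S b) b ⟨x, hx⟩
  have hlh : (⨆ b ∈ {b | (S b).Nonempty}, lipuscMod S b) ≤ hofConst S :=
    iSup₂_le fun b hb => lipuscMod_le_hofConst hb
  have hhc := hS.hofConst_le_iSup_clmMod
  exact ⟨le_antisymm (hhc.trans hcl) hlh, le_antisymm hhc (hcl.trans hlh)⟩
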